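/- arXiv:1007.0077 — 3 statements merged into one kernel-verified Lean document; each statement's English description precedes it below -/
import Mathlib

section
/- Let d ≥ 1, α ∈ (0,1], and s > 0. There exists a constant C > 0 such that for every Schwartz function g : ℝ^d → ℂ, ‖g‖_{L²(ℝ^d)}^{αd + 2s(2−α)} ≤ C · ‖g‖_{L^{2−α}(ℝ^d)}^{2s(2−α)} · ( ∫_{ℝ^d} |ξ|^{2s} |𝓕g(ξ)|² dξ )^{αd/2}. -/
open MeasureTheory FourierTransform

section NashInequality

open Module Real

variable {V : Type*} [NormedAddCommGroup V] [InnerProductSpace ℝ V] [FiniteDimensional ℝ V]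
  [MeasurableSpace V] [BorelSpace V]

theorem SchwartzMap.integrable_norm_sq (f : SchwartzMap V ℂ) :
    Integrable (fun x => ‖f x‖ ^ 2) :=
  (f.memLp 2).integrable_norm_pow (by norm_num)

theorem SchwartzMap.integrable_rpow_norm_mul_norm_sq (f : SchwartzMap V ℂ) {r : ℝ} (hr : 0 ≤ r) :
    Integrable (fun x => ‖x‖ ^ r * ‖f x‖ ^ 2) := by
  obtain ⟨K, hK⟩ := f.decay 0 0
  have hK' : ∀ x, ‖f x‖ ≤ K := fun x => by simpa using hK.2 x
  have h1 : Integrable (fun x => K * (‖f x‖ + ‖x‖ ^ ⌈r⌉₊ * ‖f x‖)) :=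
    (f.integrable.norm.add (f.integrable_pow_mul volume ⌈r⌉₊)).const_mul K
  have hcont : Continuous fun x : V => ‖x‖ ^ r * ‖f x‖ ^ 2 :=
    (continuous_norm.rpow_const fun _ => Or.inr hr).mul (f.continuous.norm.pow 2)
  refine h1.mono' hcont.aestronglyMeasurable (.of_forall fun x => ?_)
  rw [Real.norm_of_nonneg (by positivity)]
  have hx : ‖x‖ ^ r ≤ 1 + ‖x‖ ^ ⌈r⌉₊ := by
    rcases le_total ‖x‖ 1 with h | h
    · have := Real.rpow_le_one (norm_nonneg x) h hr
      have : 0 ≤ ‖x‖ ^ ⌈r⌉₊ := by positivity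
      linarith
    · have := Real.rpow_le_rpow_of_exponent_le h (Nat.le_ceil r)
      rw [Real.rpow_natCast] at this
      linarith
  calc ‖x‖ ^ r * ‖f x‖ ^ 2 = ‖x‖ ^ r * (‖f x‖ * ‖f x‖) := by ring
    _ ≤ (1 + ‖x‖ ^ ⌈r⌉₊) * (K * ‖f x‖) := by gcongr; exact hK' x
    _ = _ := by ring

theorem SchwartzMap.norm_fourierInv_apply_le (f : SchwartzMap V ℂ) (x : V) :
    ‖𝓕⁻ f x‖ ≤ ∫ ξ, ‖f ξ‖ := by
  rw [SchwartzMap.fourierInv_coe, Real.fourierInv_eq]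
  refine (norm_integral_le_integral_norm _).trans (le_of_eq ?_)
  simp_rw [Circle.norm_smul]

/-- A frequency cutoff at scale `R`: a bounded low-frequency part `P` and an `L²` control of
the remaining high-frequency part. -/
theorem SchwartzMap.exists_low_frequency_part (V : Type*) [NormedAddCommGroup V]
    [InnerProductSpace ℝ V] [FiniteDimensional ℝ V] [MeasurableSpace V] [BorelSpace V]
    {s : ℝ} (hs : 0 < s) :
    ∃ c > 0, ∀ (g : SchwartzMap V ℂ) (N R : ℝ), 0 < N → ∫ x, ‖g x‖ ^ 2 = N ^ 2 → 0 < R →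
      ∃ P : SchwartzMap V ℂ, (∀ x, ‖P x‖ ≤ c * R ^ ((finrank ℝ V : ℝ) / 2) * N) ∧
        ∫ x, ‖g x - P x‖ ^ 2 ≤ R ^ (-(2 * s)) * ∫ ξ, ‖ξ‖ ^ (2 * s) * ‖𝓕 g ξ‖ ^ 2 := by
  set v : ℝ := volume.real (Metric.ball (0 : V) 1) with hv
  have hv0 : 0 ≤ v := measureReal_nonneg
  refine ⟨(2 ^ finrank ℝ V * v + 1) / 2, by positivity, fun g N R hN hg hR => ?_⟩
  let φ : ContDiffBump (0 : V) := ⟨R, 2 * R, hR, by linarith⟩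
  have hφ : (φ : V → ℝ).HasTemperateGrowth :=
    (φ.hasCompactSupport.toSchwartzMap φ.contDiff).hasTemperateGrowth
  set u := 𝓕 g with hu
  set w := SchwartzMap.smulLeftCLM ℂ (φ : V → ℝ) u with hw
  have hwx : ∀ ξ, w ξ = φ ξ • u ξ := fun ξ => SchwartzMap.smulLeftCLM_apply_apply hφ u ξ
  have huN : ∫ ξ, ‖u ξ‖ ^ 2 = N ^ 2 := by rw [← hg, hu, g.integral_norm_sq_fourier]
  refine ⟨𝓕⁻ w, fun x => (SchwartzMap.norm_fourierInv_apply_le w x).trans ?_, ?_⟩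
  · set ρ := R ^ ((finrank ℝ V : ℝ) / 2) with hρ
    have hρ0 : 0 < ρ := by positivity
    have hρ2 : ρ ^ 2 = R ^ finrank ℝ V := by
      rw [hρ, ← Real.rpow_natCast, ← Real.rpow_mul hR.le, ← Real.rpow_natCast]
      congr 1; push_cast; ring
    have hvol : volume.real (Metric.ball (0 : V) (2 * R)) = (2 * R) ^ finrank ℝ V * v := by
      rw [hv, measureReal_def, Measure.addHaar_ball_of_pos _ _ (by linarith), ENNReal.toReal_mul,
        ENNReal.toReal_ofReal (by positivity), measureReal_def]
    have hpt : ∀ ξ, ‖w ξ‖ ≤ (Metric.ball (0 : V) (2 * R)).indicator (fun _ => N / ρ / 2) ξ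
        + ρ / N / 2 * ‖u ξ‖ ^ 2 := by
      intro ξ
      rw [hwx, norm_smul, Real.norm_of_nonneg φ.nonneg]
      by_cases hξ : ξ ∈ Metric.ball (0 : V) (2 * R)
      · rw [Set.indicator_of_mem hξ]
        have h1 : φ ξ * ‖u ξ‖ ≤ ‖u ξ‖ := mul_le_of_le_one_left (norm_nonneg _) φ.le_one
        have h2 : N / ρ / 2 + ρ / N / 2 * ‖u ξ‖ ^ 2 - ‖u ξ‖
            = ρ / N / 2 * (‖u ξ‖ - N / ρ) ^ 2 := by
          field_simp; ring
        have h3 : 0 ≤ ρ / N / 2 * (‖u ξ‖ - N / ρ) ^ 2 := by positivity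
        linarith
      · have : φ ξ = 0 := φ.zero_of_le_dist (by simpa using hξ)
        rw [this, Set.indicator_of_notMem hξ]
        simp only [zero_mul, zero_add]
        positivity
    have hind : Integrable ((Metric.ball (0 : V) (2 * R)).indicator (fun _ => N / ρ / 2)) :=
      (integrable_indicator_iff measurableSet_ball).2 (integrableOn_const measure_ball_lt_top.ne)
    have husq := u.integrable_norm_sq.const_mul (ρ / N / 2)
    refine (integral_mono w.integrable.norm (hind.add husq) hpt).trans (le_of_eq ?_)
    simp only [Pi.add_apply]
    rw [integral_add hind husq, integral_indicator_const _ measurableSet_ball, hvol,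
      integral_const_mul, huN, mul_pow, ← hρ2, smul_eq_mul]
    field_simp
  · have h1 : ∫ x, ‖g x - 𝓕⁻ w x‖ ^ 2 = ∫ ξ, ‖u ξ - w ξ‖ ^ 2 := by
      have := (g - 𝓕⁻ w).integral_norm_sq_fourier
      rw [sub_eq_add_neg, FourierTransform.fourier_add, FourierTransform.fourier_neg,
        FourierTransform.fourier_fourierInv_eq, ← sub_eq_add_neg, ← sub_eq_add_neg] at this
      simpa using this.symm
    have hint := (u.integrable_rpow_norm_mul_norm_sq (r := 2 * s) (by positivity))
    rw [h1, ← integral_const_mul]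
    refine integral_mono (by simpa using (u - w).integrable_norm_sq) (hint.const_mul _)
      fun ξ => ?_
    simp only [hwx]
    by_cases hξ : ‖ξ‖ ≤ R
    · have : φ ξ = 1 := φ.one_of_mem_closedBall (by simpa [φ] using hξ)
      rw [this]
      simp only [one_smul, sub_self, norm_zero, ne_eq, OfNat.ofNat_ne_zero, not_false_eq_true,
        zero_pow]
      positivity
    · have h2 : ‖u ξ - φ ξ • u ξ‖ ≤ ‖u ξ‖ := by
        have : u ξ - φ ξ • u ξ = (1 - φ ξ) • u ξ := by rw [sub_smul, one_smul]
        rw [this, norm_smul, Real.norm_of_nonneg (by linarith [φ.le_one (x := ξ)])]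
        exact mul_le_of_le_one_left (norm_nonneg _) (by linarith [φ.nonneg (x := ξ)])
      have h3 : 1 ≤ R ^ (-(2 * s)) * ‖ξ‖ ^ (2 * s) := by
        rw [Real.rpow_neg hR.le, inv_mul_eq_div, one_le_div (by positivity)]
        exact Real.rpow_le_rpow hR.le (not_le.1 hξ).le (by positivity)
      calc ‖u ξ - φ ξ • u ξ‖ ^ 2 ≤ 1 * ‖u ξ‖ ^ 2 := by rw [one_mul]; gcongr
        _ ≤ (R ^ (-(2 * s)) * ‖ξ‖ ^ (2 * s)) * ‖u ξ‖ ^ 2 := by gcongr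
        _ = _ := by ring

/-- Splitting according to whether `|a| ≤ t`, where `B` bounds the part `b` of `a`. -/
theorem sq_le_of_le_add {a b h B t α : ℝ} (ha : 0 ≤ a) (hB : 0 ≤ B) (hb : b ≤ B)
    (hab : a ≤ b + h) (ht : 0 < t) (hα : 0 < α) (hα1 : α ≤ 1) :
    a ^ 2 ≤ 2 * (t ^ α + t ^ (α - 1) * B) * a ^ (2 - α) + h ^ 2 := by
  rcases ha.eq_or_lt with rfl | ha
  · rw [Real.zero_rpow (by linarith)]; nlinarith [sq_nonneg h]
  rcases le_or_gt a t with hat | hat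
  · have h1 : a ^ 2 = a ^ α * a ^ (2 - α) := by
      rw [← Real.rpow_add ha, ← Real.rpow_natCast]; congr 1; push_cast; ring
    have h2 : a ^ α * a ^ (2 - α) ≤ t ^ α * a ^ (2 - α) := by gcongr
    have h3 : 0 ≤ (t ^ α + 2 * (t ^ (α - 1) * B)) * a ^ (2 - α) := by positivity
    nlinarith [sq_nonneg h]
  · have h1 : a = a ^ (α - 1) * a ^ (2 - α) := by
      rw [← Real.rpow_add ha]; conv_lhs => rw [← Real.rpow_one a]
      congr 1; ring
    have h2 : a ≤ t ^ (α - 1) * a ^ (2 - α) := by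
      conv_lhs => rw [h1]
      gcongr ?_ * _
      exact Real.rpow_le_rpow_of_nonpos ht hat.le (by linarith)
    have h3 : a * B ≤ t ^ (α - 1) * a ^ (2 - α) * B := by gcongr
    have h4 : 0 ≤ t ^ α * a ^ (2 - α) := by positivity
    have h5 : a * a ≤ a * (B + h) := by gcongr; linarith
    nlinarith [sq_nonneg (a - h)]

/-- Optimization over the two parameters `t`, `R`. -/
theorem rpow_le_of_forall_sq_le {α s δ c : ℝ} (hα : 0 < α) (hs : 0 < s) (hδ : 0 < δ)
    (hc : 0 < c) :
    ∃ C > 0, ∀ N M A : ℝ, 0 < N → 0 < M → 0 ≤ A →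
      (∀ t R : ℝ, 0 < t → 0 < R →
        N ^ 2 ≤ 2 * (t ^ α + t ^ (α - 1) * (c * R ^ (δ / 2) * N)) * M + R ^ (-(2 * s)) * A) →
      N ^ (α * δ + 2 * s * (2 - α)) ≤ C * M ^ (2 * s) * A ^ (α * δ / 2) := by
  refine ⟨exp (2 * s * α * (log (8 * c) + (1 - α) / α * log 8 + δ / (4 * s) * log 4)),
    exp_pos _, fun N M A hN hM hA h => ?_⟩
  set t := (N ^ 2 / (8 * M)) ^ α⁻¹ with ht
  have ht0 : 0 < t := by positivity
  have htα : t ^ α * M = N ^ 2 / 8 := by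
    rw [ht, ← Real.rpow_mul (by positivity), inv_mul_cancel₀ hα.ne', Real.rpow_one]
    field_simp
  rcases hA.eq_or_lt with rfl | hA
  · exfalso
    have hq : 0 < N / (8 * c * t ^ (α - 1) * M) := by positivity
    have h1 := h t ((N / (8 * c * t ^ (α - 1) * M)) ^ (2 / δ)) ht0 (by positivity)
    rw [← Real.rpow_mul hq.le, show 2 / δ * (δ / 2) = 1 by field_simp, Real.rpow_one] at h1
    have h2 : t ^ (α - 1) * (c * (N / (8 * c * t ^ (α - 1) * M)) * N) * M = N ^ 2 / 8 := by
      field_simp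
    have : 0 < N ^ 2 := by positivity
    nlinarith
  set R := (4 * A / N ^ 2) ^ (2 * s)⁻¹ with hR
  have hR0 : 0 < R := by positivity
  have hRs : R ^ (-(2 * s)) * A = N ^ 2 / 4 := by
    rw [Real.rpow_neg hR0.le, hR, ← Real.rpow_mul (by positivity),
      inv_mul_cancel₀ (by positivity), Real.rpow_one]
    field_simp
  have h1 := h t R ht0 hR0
  rw [hRs] at h1
  have h2 : N ≤ 4 * c * t ^ (α - 1) * M * R ^ (δ / 2) := by
    refine le_of_mul_le_mul_right ?_ hN
    nlinarith
  have h3 : log N ≤ log (8 * c) + (α - 1) * (α⁻¹ * (2 * log N - (log 8 + log M))) + log M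
      + δ / 2 * ((2 * s)⁻¹ * (log 4 + log A - 2 * log N)) := by
    have h4 : N ≤ 8 * c * t ^ (α - 1) * M * R ^ (δ / 2) := by
      refine h2.trans ?_
      gcongr
      norm_num
    have h5 := Real.log_le_log hN h4
    rw [Real.log_mul (y := R ^ (δ / 2)) (by positivity) (by positivity),
      Real.log_mul (y := M) (by positivity) (by positivity),
      Real.log_mul (y := t ^ (α - 1)) (by positivity) (by positivity), Real.log_rpow ht0, Real.log_rpow hR0, ht, hR,
      Real.log_rpow (by positivity), Real.log_rpow (by positivity),
      Real.log_div (by positivity) (by positivity), Real.log_div (by positivity) (by positivity),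
      Real.log_mul (y := M) (by norm_num) (by positivity),
      Real.log_mul (y := A) (by norm_num) (by positivity), Real.log_pow] at h5
    push_cast at h5
    exact h5
  rw [Real.rpow_def_of_pos hN, Real.rpow_def_of_pos hM, Real.rpow_def_of_pos hA, ← Real.exp_add,
    ← Real.exp_add, Real.exp_le_exp]
  have h6 := mul_le_mul_of_nonneg_left h3 (by positivity : 0 ≤ 2 * s * α)
  have h7 : 2 * s * α * (log (8 * c) + (α - 1) * (α⁻¹ * (2 * log N - (log 8 + log M))) + log M
      + δ / 2 * ((2 * s)⁻¹ * (log 4 + log A - 2 * log N)))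
      = 2 * s * α * (log (8 * c) + (1 - α) / α * log 8 + δ / (4 * s) * log 4) + log M * (2 * s)
        + log A * (α * δ / 2) + 2 * s * α * log N
        - log N * (α * δ + 2 * s * (2 - α)) := by
    field_simp
    ring
  linarith

end NashInequality

/-- generalized Nash inequality. For d ≥ 1, α ∈ (0,1], s > 0, there is C > 0
such that for every Schwartz function g : ℝ^d → ℂ,
‖g‖₂^{αd+2s(2−α)} ≤ C ‖g‖_{2−α}^{2s(2−α)} (∫ |ξ|^{2s} |𝓕g(ξ)|² dξ)^{αd/2}. -/
theorem stmt_4 (d : ℕ) (hd : 1 ≤ d) (α s : ℝ) (hα : 0 < α) (hα1 : α ≤ 1) (hs : 0 < s) :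
    ∃ C > 0, ∀ g : SchwartzMap (EuclideanSpace ℝ (Fin d)) ℂ,
      (eLpNorm (⇑g) 2 volume).toReal ^ (α * d + 2 * s * (2 - α)) ≤
        C * (eLpNorm (⇑g) (ENNReal.ofReal (2 - α)) volume).toReal ^ (2 * s * (2 - α)) *
          (∫ ξ : EuclideanSpace ℝ (Fin d), ‖ξ‖ ^ (2 * s) * ‖𝓕 (⇑g) ξ‖ ^ 2) ^ (α * d / 2) := by
  have hd0 : (0 : ℝ) < d := by exact_mod_cast hd
  have hp : 0 < 2 - α := by linarith
  obtain ⟨c, hc, hcut⟩ :=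
    SchwartzMap.exists_low_frequency_part (EuclideanSpace ℝ (Fin d)) hs
  obtain ⟨C, hC, hopt⟩ := rpow_le_of_forall_sq_le hα hs hd0 hc
  refine ⟨C, hC, fun g => ?_⟩
  set N := (eLpNorm (⇑g) 2 volume).toReal with hN
  set L := (eLpNorm (⇑g) (ENNReal.ofReal (2 - α)) volume).toReal with hL
  have hA : 0 ≤ ∫ ξ : EuclideanSpace ℝ (Fin d), ‖ξ‖ ^ (2 * s) * ‖𝓕 (⇑g) ξ‖ ^ 2 :=
    integral_nonneg fun ξ => by positivity
  have hL0 : 0 ≤ L := ENNReal.toReal_nonneg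
  have hNn : 0 ≤ N := ENNReal.toReal_nonneg
  have hp0 : ENNReal.ofReal (2 - α) ≠ 0 := by simpa using hp
  rcases hNn.eq_or_lt with h0 | hN0
  · rw [← h0, Real.zero_rpow (by positivity)]
    positivity
  have hLpos : 0 < L := by
    refine hL0.lt_of_ne fun h => hN0.ne' ?_
    have hLtop := (g.memLp (ENNReal.ofReal (2 - α)) volume).eLpNorm_ne_top
    have h1 : eLpNorm (⇑g) (ENNReal.ofReal (2 - α)) volume = 0 :=
      ((ENNReal.toReal_eq_zero_iff _).1 h.symm).resolve_right hLtop
    have h2 := (eLpNorm_eq_zero_iff g.continuous.aestronglyMeasurable hp0).1 h1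
    have h3 : eLpNorm (⇑g) 2 volume = 0 :=
      (eLpNorm_eq_zero_iff g.continuous.aestronglyMeasurable two_ne_zero).2 h2
    rw [hN, h3, ENNReal.toReal_zero]
  have hN2 : ∫ x, ‖g x‖ ^ 2 = N ^ 2 := by
    have h := (g.memLp 2).eLpNorm_eq_integral_rpow_norm (by norm_num) (by norm_num)
    have h2 : 0 ≤ ∫ x, ‖g x‖ ^ 2 := integral_nonneg fun x => by positivity
    simp only [ENNReal.toReal_ofNat, Real.rpow_ofNat] at h
    rw [hN, h, ENNReal.toReal_ofReal (by positivity), ← Real.rpow_natCast, ← Real.rpow_mul h2]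
    norm_num
  have hLp : ∫ x, ‖g x‖ ^ (2 - α) = L ^ (2 - α) := by
    have h := (g.memLp (ENNReal.ofReal (2 - α))).eLpNorm_eq_integral_rpow_norm hp0 (by simp)
    have h2 : 0 ≤ ∫ x, ‖g x‖ ^ (2 - α) := integral_nonneg fun x => by positivity
    rw [ENNReal.toReal_ofReal hp.le] at h
    rw [hL, h, ENNReal.toReal_ofReal (by positivity), ← Real.rpow_mul h2,
      inv_mul_cancel₀ hp.ne', Real.rpow_one]
  rw [show 2 * s * (2 - α) = (2 - α) * (2 * s) by ring, Real.rpow_mul hL0,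
    show (2 - α) * (2 * s) = 2 * s * (2 - α) by ring]
  refine hopt N (L ^ (2 - α)) _ hN0 (by positivity) hA fun t R ht hR => ?_
  obtain ⟨P, hP, hPint⟩ := hcut g N R hN0 hN2 hR
  simp only [finrank_euclideanSpace, Fintype.card_fin] at hP
  rw [SchwartzMap.fourier_coe] at hPint
  set B := c * R ^ ((d : ℝ) / 2) * N
  have hLint : Integrable fun x => ‖g x‖ ^ (2 - α) := by
    have := (g.memLp (ENNReal.ofReal (2 - α))).integrable_norm_rpow hp0 (by simp)
    rwa [ENNReal.toReal_ofReal hp.le] at this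
  have hPi : Integrable fun x => ‖g x - P x‖ ^ 2 := by simpa using (g - P).integrable_norm_sq
  have hpt := integral_mono g.integrable_norm_sq
    ((hLint.const_mul (2 * (t ^ α + t ^ (α - 1) * B))).add hPi) fun x =>
      sq_le_of_le_add (norm_nonneg (g x)) (by positivity) (hP x)
        (by simpa using norm_add_le (P x) (g x - P x)) ht hα hα1
  simp only [Pi.add_apply] at hpt
  rw [integral_add (hLint.const_mul _) hPi, integral_const_mul, hN2, hLp] at hpt
  linarith
end

section
/- Let d ≥ 1 and α ∈ (0,1]. There exists a constant C > 0 such that for every Schwartz function g : ℝ^d → ℂ, ‖g‖_{L²(ℝ^d)}^{αd + 4 − 2α} ≤ C · ‖g‖_{L^{2−α}(ℝ^d)}^{2(2−α)} · ‖∇g‖_{L²(ℝ^d)}^{αd}. -/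
open MeasureTheory

theorem lintegral_rpow_le_lintegral_rpow {X : Type*} [MeasurableSpace X] (μ : Measure X)
    [IsProbabilityMeasure μ] {f : X → ENNReal} (hf : AEMeasurable f μ) {q : ℝ} (hq : 1 ≤ q) :
    (∫⁻ x, f x ∂μ) ^ q ≤ ∫⁻ x, f x ^ q ∂μ := by
  have h := eLpNorm'_le_eLpNorm'_of_exponent_le one_pos hq μ hf.aestronglyMeasurable
  have h0 : 0 < q := by linarith
  simpa [eLpNorm', ← ENNReal.rpow_mul, inv_mul_cancel₀ h0.ne'] using ENNReal.rpow_le_rpow h h0.le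

section

variable {E : Type*} [NormedAddCommGroup E] [NormedSpace ℝ E]

theorem enorm_sub_rpow_two_le_lintegral_fderiv {g : E → ℂ} (hg : ContDiff ℝ 1 g) (x y : E) :
    ‖g (x + y) - g x‖ₑ ^ (2 : ℝ) ≤
      ‖y‖ₑ ^ (2 : ℝ) * ∫⁻ t in Set.Ioc (0 : ℝ) 1, ‖fderiv ℝ g (x + t • y)‖ₑ ^ (2 : ℝ) := by
  have hc : Continuous fun t : ℝ ↦ fderiv ℝ g (x + t • y) :=
    (hg.continuous_fderiv one_ne_zero).comp (by fun_prop)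
  have hftc : ∫ t in (0 : ℝ)..1, fderiv ℝ g (x + t • y) y = g (x + y) - g x := by
    have h := intervalIntegral.integral_eq_sub_of_hasDerivAt (a := 0) (b := 1)
      (f := fun t : ℝ ↦ g (x + t • y)) (f' := fun t ↦ fderiv ℝ g (x + t • y) y)
      (fun t _ ↦ ?_) ((hc.clm_apply continuous_const).intervalIntegrable _ _)
    · simpa using h
    · have hd := (hg.differentiable one_ne_zero (x + t • y)).hasFDerivAt
      have hl : HasDerivAt (fun t : ℝ ↦ x + t • y) y t := by
        simpa using ((hasDerivAt_id t).smul_const y).const_add x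
      exact hd.comp_hasDerivAt t hl
  have hprob : IsProbabilityMeasure (volume.restrict (Set.Ioc (0 : ℝ) 1)) := ⟨by simp⟩
  rw [← hftc, intervalIntegral.integral_of_le zero_le_one]
  calc _ ≤ (∫⁻ t in Set.Ioc (0 : ℝ) 1, ‖y‖ₑ * ‖fderiv ℝ g (x + t • y)‖ₑ) ^ (2 : ℝ) := by
        refine ENNReal.rpow_le_rpow ((enorm_integral_le_lintegral_enorm _).trans ?_) (by norm_num)
        refine lintegral_mono fun t ↦ ?_
        rw [mul_comm]
        exact ContinuousLinearMap.le_opENorm _ _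
    _ = ‖y‖ₑ ^ (2 : ℝ) * (∫⁻ t in Set.Ioc (0 : ℝ) 1, ‖fderiv ℝ g (x + t • y)‖ₑ) ^ (2 : ℝ) := by
        rw [lintegral_const_mul _ hc.enorm.measurable, ENNReal.mul_rpow_of_nonneg _ _ (by norm_num)]
    _ ≤ _ := by
        gcongr
        exact lintegral_rpow_le_lintegral_rpow _ hc.enorm.measurable.aemeasurable (by norm_num)

variable [MeasurableSpace E] [BorelSpace E] [FiniteDimensional ℝ E]
  (μ : Measure E) [μ.IsAddHaarMeasure]

theorem lintegral_enorm_sub_rpow_two_le {g : E → ℂ} (hg : ContDiff ℝ 1 g) (y : E) :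
    ∫⁻ x, ‖g (x + y) - g x‖ₑ ^ (2 : ℝ) ∂μ ≤
      ‖y‖ₑ ^ (2 : ℝ) * ∫⁻ x, ‖fderiv ℝ g x‖ₑ ^ (2 : ℝ) ∂μ := by
  have hc : Continuous fun z : E × ℝ ↦ fderiv ℝ g (z.1 + z.2 • y) :=
    (hg.continuous_fderiv one_ne_zero).comp (by fun_prop)
  have hm : Measurable fun z : E × ℝ ↦ ‖fderiv ℝ g (z.1 + z.2 • y)‖ₑ ^ (2 : ℝ) :=
    hc.enorm.measurable.pow_const _
  calc _ ≤ ∫⁻ x, (‖y‖ₑ ^ (2 : ℝ) *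
          ∫⁻ t in Set.Ioc (0 : ℝ) 1, ‖fderiv ℝ g (x + t • y)‖ₑ ^ (2 : ℝ)) ∂μ :=
        lintegral_mono fun x ↦ enorm_sub_rpow_two_le_lintegral_fderiv hg x y
    _ = ‖y‖ₑ ^ (2 : ℝ) * ∫⁻ t in Set.Ioc (0 : ℝ) 1,
          ∫⁻ x, ‖fderiv ℝ g (x + t • y)‖ₑ ^ (2 : ℝ) ∂μ := by
        rw [lintegral_const_mul _ hm.lintegral_prod_right',
          lintegral_lintegral_swap hm.aemeasurable]
    _ = _ := by
        congr 1
        simp_rw [fun t : ℝ ↦ lintegral_add_right_eq_self (μ := μ)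
          (fun x ↦ ‖fderiv ℝ g x‖ₑ ^ (2 : ℝ)) (t • y)]
        simp

/-- Local averaging: if `ν` is a probability measure concentrated on the ball of radius `r` and
with density at most `c`, then the `L²` norm of `g` is controlled by its gradient and its
`L^p` norm. -/
theorem lintegral_rpow_two_le_of_average {g : E → ℂ} (hg : ContDiff ℝ 1 g) {p : ℝ}
    (hp : 1 ≤ p) (hp2 : p ≤ 2) (ν : Measure E) [IsProbabilityMeasure ν] {c r : ENNReal}
    (hν : ν ≤ c • μ) (hr : ∀ᵐ y ∂ν, ‖y‖ₑ ≤ r) :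
    ∫⁻ x, ‖g x‖ₑ ^ (2 : ℝ) ∂μ ≤
      2 * (r ^ (2 : ℝ) * ∫⁻ x, ‖fderiv ℝ g x‖ₑ ^ (2 : ℝ) ∂μ) +
        2 * (c ^ (2 / p - 1) * (∫⁻ x, ‖g x‖ₑ ^ p ∂μ) ^ (2 / p)) := by
  have hp0 : 0 < p := by linarith
  have h2p : 0 ≤ 2 / p - 1 := by rw [sub_nonneg, le_div_iff₀ hp0]; linarith
  have hgc := hg.continuous
  set N := ∫⁻ x, ‖g x‖ₑ ^ p ∂μ with hN
  have hmd : Measurable fun z : E × E ↦ ‖g (z.1 + z.2) - g z.1‖ₑ ^ (2 : ℝ) :=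
    (by fun_prop : Continuous fun z : E × E ↦ g (z.1 + z.2) - g z.1).enorm.measurable.pow_const _
  have hmp : Measurable fun z : E × E ↦ ‖g (z.1 + z.2)‖ₑ ^ p :=
    (by fun_prop : Continuous fun z : E × E ↦ g (z.1 + z.2)).enorm.measurable.pow_const _
  have hm1 (x : E) : Measurable fun y ↦ ‖g (x + y) - g x‖ₑ :=
    (by fun_prop : Continuous fun y ↦ g (x + y) - g x).enorm.measurable
  have hm2 (x : E) : Measurable fun y ↦ ‖g (x + y)‖ₑ :=
    (by fun_prop : Continuous fun y ↦ g (x + y)).enorm.measurable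
  have hsup (x : E) : ∫⁻ y, ‖g (x + y)‖ₑ ^ p ∂ν ≤ c * N := by
    calc _ ≤ ∫⁻ y, ‖g (x + y)‖ₑ ^ p ∂(c • μ) := lintegral_mono' hν le_rfl
      _ = c * N := by
        rw [lintegral_smul_measure, lintegral_add_left_eq_self (fun y ↦ ‖g y‖ₑ ^ p) x, smul_eq_mul]
  have hpt (x : E) : ‖g x‖ₑ ^ (2 : ℝ) ≤ 2 * (∫⁻ y, ‖g (x + y) - g x‖ₑ ^ (2 : ℝ) ∂ν) +
      2 * ((c * N) ^ (2 / p - 1) * ∫⁻ y, ‖g (x + y)‖ₑ ^ p ∂ν) := by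
    have hJ := lintegral_rpow_le_lintegral_rpow ν (hm2 x).aemeasurable hp
    have hsecond : (∫⁻ y, ‖g (x + y)‖ₑ ∂ν) ^ (2 : ℝ) ≤
        (c * N) ^ (2 / p - 1) * ∫⁻ y, ‖g (x + y)‖ₑ ^ p ∂ν := by
      calc _ = (((∫⁻ y, ‖g (x + y)‖ₑ ∂ν) ^ p) ^ (2 / p - 1)) * (∫⁻ y, ‖g (x + y)‖ₑ ∂ν) ^ p := by
            rw [← ENNReal.rpow_mul, ← ENNReal.rpow_add_of_nonneg _ _ (by positivity) hp0.le]
            congr 1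
            field_simp
            ring
        _ ≤ _ := by
            gcongr
            exact hJ.trans (hsup x)
    calc _ ≤ ((∫⁻ y, ‖g (x + y) - g x‖ₑ ∂ν) + ∫⁻ y, ‖g (x + y)‖ₑ ∂ν) ^ (2 : ℝ) := by
          refine ENNReal.rpow_le_rpow ?_ (by norm_num)
          rw [← lintegral_add_left (hm1 x)]
          calc ‖g x‖ₑ = ∫⁻ _, ‖g x‖ₑ ∂ν := by simp
            _ ≤ _ := lintegral_mono fun y ↦ by
              have h := enorm_sub_le (a := g (x + y)) (b := g (x + y) - g x)
              rw [sub_sub_cancel] at h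
              rwa [add_comm]
      _ ≤ _ := by
          refine (ENNReal.rpow_add_le_mul_rpow_add_rpow _ _ (by norm_num)).trans ?_
          rw [mul_add]
          norm_num only [ENNReal.rpow_one]
          gcongr
          exact lintegral_rpow_le_lintegral_rpow ν (hm1 x).aemeasurable (by norm_num)
  calc _ ≤ ∫⁻ x, (2 * (∫⁻ y, ‖g (x + y) - g x‖ₑ ^ (2 : ℝ) ∂ν) +
      2 * ((c * N) ^ (2 / p - 1) * ∫⁻ y, ‖g (x + y)‖ₑ ^ p ∂ν)) ∂μ := lintegral_mono hpt
    _ = 2 * (∫⁻ y, ∫⁻ x, ‖g (x + y) - g x‖ₑ ^ (2 : ℝ) ∂μ ∂ν) +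
      2 * ((c * N) ^ (2 / p - 1) * ∫⁻ y, ∫⁻ x, ‖g (x + y)‖ₑ ^ p ∂μ ∂ν) := by
        rw [lintegral_add_left (hmd.lintegral_prod_right'.const_mul _),
          lintegral_const_mul _ hmd.lintegral_prod_right',
          lintegral_const_mul _ (hmp.lintegral_prod_right'.const_mul _),
          lintegral_const_mul _ hmp.lintegral_prod_right',
          lintegral_lintegral_swap (f := fun x y ↦ ‖g (x + y) - g x‖ₑ ^ (2 : ℝ)) hmd.aemeasurable,
          lintegral_lintegral_swap (f := fun x y ↦ ‖g (x + y)‖ₑ ^ p) hmp.aemeasurable]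
    _ ≤ _ := by
        refine add_le_add (mul_le_mul' le_rfl ?_) (mul_le_mul' le_rfl ?_)
        · calc _ ≤ ∫⁻ _, r ^ (2 : ℝ) * ∫⁻ x, ‖fderiv ℝ g x‖ₑ ^ (2 : ℝ) ∂μ ∂ν := by
                refine lintegral_mono_ae ?_
                filter_upwards [hr] with y hy
                refine (lintegral_enorm_sub_rpow_two_le μ hg y).trans ?_
                gcongr
            _ = _ := by simp
        · simp_rw [fun y ↦ lintegral_add_right_eq_self (μ := μ) (fun x ↦ ‖g x‖ₑ ^ p) y]
          rw [lintegral_const, measure_univ, mul_one, ENNReal.mul_rpow_of_nonneg _ _ h2p, mul_assoc]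
          gcongr
          have h := ENNReal.rpow_add_of_nonneg (x := N) _ _ h2p zero_le_one
          rw [sub_add_cancel, ENNReal.rpow_one] at h
          exact h.ge

theorem lintegral_rpow_two_le_ball [Nontrivial E] {g : E → ℂ} (hg : ContDiff ℝ 1 g) {p : ℝ}
    (hp : 1 ≤ p) (hp2 : p ≤ 2) {r : ℝ} (hr : 0 < r) :
    ∫⁻ x, ‖g x‖ₑ ^ (2 : ℝ) ∂μ ≤
      2 * (ENNReal.ofReal r ^ (2 : ℝ) * ∫⁻ x, ‖fderiv ℝ g x‖ₑ ^ (2 : ℝ) ∂μ) +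
        2 * ((ENNReal.ofReal (r ^ Module.finrank ℝ E) * μ (Metric.ball 0 1))⁻¹ ^ (2 / p - 1) *
          (∫⁻ x, ‖g x‖ₑ ^ p ∂μ) ^ (2 / p)) := by
  rw [← Measure.addHaar_ball μ (0 : E) hr.le]
  have hpos : μ (Metric.ball (0 : E) r) ≠ 0 := (Metric.measure_ball_pos μ 0 hr).ne'
  have hfin : μ (Metric.ball (0 : E) r) ≠ ⊤ := measure_ball_lt_top.ne
  have := ProbabilityTheory.cond_isProbabilityMeasure_of_finite hpos hfin
  refine lintegral_rpow_two_le_of_average μ hg hp hp2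
    (ProbabilityTheory.cond μ (Metric.ball 0 r)) ?_ ?_
  · rw [ProbabilityTheory.cond]
    gcongr
    exact Measure.restrict_le_self
  · refine (Measure.smul_absolutelyContinuous).ae_le ?_
    filter_upwards [ae_restrict_mem Metric.isOpen_ball.measurableSet] with y hy
    rw [← ofReal_norm]
    exact ENNReal.ofReal_le_ofReal (by simpa using (mem_ball_zero_iff.1 hy).le)

end

theorem rpow_le_of_forall_le {A B G K k : ℝ} (hA : 0 ≤ A) (hG : 0 ≤ G) (hK : 0 ≤ K)
    (hk : 0 < k) (h : ∀ r : ℝ, 0 < r → A ^ 2 ≤ 2 * (r ^ 2 * G ^ 2) + 2 * (K * r ^ (-k) * B ^ 2)) :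
    A ^ (2 + k) ≤ 4 * K * 2 ^ k * (B ^ 2 * G ^ k) := by
  rcases hA.eq_or_lt with rfl | hA
  · rw [Real.zero_rpow (by positivity)]
    positivity
  have key : ∀ H, G < H → A ^ (2 + k) ≤ 4 * K * 2 ^ k * (B ^ 2 * H ^ k) := by
    intro H hGH
    have hH : 0 < H := hG.trans_lt hGH
    have hr := h (A / (2 * H)) (by positivity)
    have h1 : (A / (2 * H)) ^ 2 * G ^ 2 ≤ A ^ 2 / 4 := by
      calc _ ≤ (A / (2 * H)) ^ 2 * H ^ 2 := by gcongr
        _ = _ := by field_simp; norm_num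
    rw [Real.rpow_neg (by positivity), Real.div_rpow hA.le (by positivity),
      Real.mul_rpow (by norm_num) hH.le] at hr
    have h2 : A ^ 2 ≤ 4 * (K * (A ^ k / (2 ^ k * H ^ k))⁻¹ * B ^ 2) := by linarith
    rw [Real.rpow_add hA, Real.rpow_two]
    calc _ ≤ 4 * (K * (A ^ k / (2 ^ k * H ^ k))⁻¹ * B ^ 2) * A ^ k := by gcongr
      _ = _ := by
        have := Real.rpow_pos_of_pos hA k
        field_simp
  have hcont : Continuous fun H : ℝ ↦ 4 * K * 2 ^ k * (B ^ 2 * H ^ k) := by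
    have := Real.continuous_rpow_const hk.le
    fun_prop
  exact ge_of_tendsto (hcont.continuousWithinAt (s := Set.Ioi G) (x := G)).tendsto
    (eventually_nhdsWithin_of_forall key)

/-- Nash-type inequality with one derivative. For d ≥ 1 and α ∈ (0,1], there is
C > 0 such that for every Schwartz function g : ℝ^d → ℂ,
‖g‖₂^{αd+4−2α} ≤ C ‖g‖_{2−α}^{2(2−α)} ‖∇g‖₂^{αd}. -/
theorem stmt_6 (d : ℕ) (hd : 1 ≤ d) (α : ℝ) (hα : 0 < α) (hα1 : α ≤ 1) :
    ∃ C > 0, ∀ g : SchwartzMap (EuclideanSpace ℝ (Fin d)) ℂ,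
      (eLpNorm (⇑g) 2 volume).toReal ^ (α * d + 4 - 2 * α) ≤
        C * (eLpNorm (⇑g) (ENNReal.ofReal (2 - α)) volume).toReal ^ (2 * (2 - α)) *
          ((∫ x : EuclideanSpace ℝ (Fin d), ‖fderiv ℝ (⇑g) x‖ ^ 2) ^ ((1 : ℝ) / 2)) ^ (α * d) := by
  have : NeZero d := ⟨by omega⟩
  have hp : 1 ≤ 2 - α := by linarith
  have hp0 : 0 < 2 - α := by linarith
  have hd0 : (0 : ℝ) < d := by exact_mod_cast hd
  set E := EuclideanSpace ℝ (Fin d)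
  set p := 2 - α with hpdef
  set V : ℝ := (volume (Metric.ball (0 : E) 1)).toReal with hV
  have hVtop : volume (Metric.ball (0 : E) 1) ≠ ⊤ := measure_ball_lt_top.ne
  have hV0 : 0 < V := ENNReal.toReal_pos (Metric.measure_ball_pos _ _ one_pos).ne' hVtop
  set e := 2 / p - 1 with he
  have hep : e * p = α := by
    rw [he, sub_mul, div_mul_cancel₀ _ hp0.ne', hpdef]; ring
  have he0 : 0 < e := by
    rw [he, sub_pos, lt_div_iff₀ hp0]; linarith
  set K := V⁻¹ ^ e with hKdef
  have hK : 0 < K := by positivity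
  refine ⟨(4 * K * 2 ^ (d * e)) ^ p, by positivity, fun g ↦ ?_⟩
  set A := (eLpNorm g 2 volume).toReal with hA
  set B := (eLpNorm g (ENNReal.ofReal p) volume).toReal with hB
  set G := (∫ x : E, ‖fderiv ℝ g x‖ ^ 2) ^ ((1 : ℝ) / 2) with hG
  have hA0 : 0 ≤ A := ENNReal.toReal_nonneg
  have hB0 : 0 ≤ B := ENNReal.toReal_nonneg
  have hG0 : 0 ≤ G := by positivity
  have hmemp : ∫⁻ x, ‖g x‖ₑ ^ p ≠ ⊤ := by
    simpa [ENNReal.toReal_ofReal hp0.le] using (lintegral_rpow_enorm_lt_top_of_eLpNorm_lt_top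
      (by simpa using hp0) ENNReal.ofReal_ne_top (g.memLp (ENNReal.ofReal p)).2).ne
  have hmemD : ∫⁻ x, ‖fderiv ℝ g x‖ₑ ^ (2 : ℝ) ≠ ⊤ := by
    simpa using (lintegral_rpow_enorm_lt_top_of_eLpNorm_lt_top two_ne_zero ENNReal.ofNat_ne_top
      ((SchwartzMap.fderivCLM ℝ E ℂ g).memLp 2).2).ne
  have hA2 : (∫⁻ x, ‖g x‖ₑ ^ (2 : ℝ)).toReal = A ^ 2 := by
    rw [hA, eLpNorm_eq_lintegral_rpow_enorm_toReal two_ne_zero ENNReal.ofNat_ne_top,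
      ← ENNReal.toReal_pow, ← ENNReal.rpow_natCast, ← ENNReal.rpow_mul]
    norm_num
  have hB2 : (∫⁻ x, ‖g x‖ₑ ^ p).toReal ^ (2 / p) = B ^ 2 := by
    rw [hB, eLpNorm_eq_lintegral_rpow_enorm_toReal (by simpa using hp0) ENNReal.ofReal_ne_top,
      ENNReal.toReal_ofReal hp0.le, ← ENNReal.toReal_pow, ← ENNReal.rpow_natCast,
      ← ENNReal.rpow_mul, ENNReal.toReal_rpow]
    congr 2
    push_cast
    ring
  have hG2 : (∫⁻ x, ‖fderiv ℝ g x‖ₑ ^ (2 : ℝ)).toReal = G ^ 2 := by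
    have hc : Continuous (fderiv ℝ g) := (g.smooth 1).continuous_fderiv one_ne_zero
    rw [hG, ← Real.rpow_natCast, ← Real.rpow_mul (by positivity),
      integral_eq_lintegral_of_nonneg_ae (.of_forall fun x ↦ sq_nonneg _)
        (by fun_prop : Continuous fun x ↦ ‖fderiv ℝ g x‖ ^ 2).aestronglyMeasurable]
    norm_num only [Real.rpow_one]
    congr 1
    refine lintegral_congr fun x ↦ ?_
    rw [ENNReal.ofReal_pow (norm_nonneg _), ofReal_norm, ← ENNReal.rpow_natCast]
    norm_num
  have hmain : ∀ r : ℝ, 0 < r →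
      A ^ 2 ≤ 2 * (r ^ 2 * G ^ 2) + 2 * (K * r ^ (-(d * e)) * B ^ 2) := by
    intro r hr
    have h := lintegral_rpow_two_le_ball volume (g.smooth 1) hp (by linarith : p ≤ 2) hr
    have hball : (ENNReal.ofReal (r ^ Module.finrank ℝ E) *
        volume (Metric.ball (0 : E) 1))⁻¹ ^ (2 / p - 1) ≠ ⊤ := by
      refine ENNReal.rpow_ne_top_of_nonneg he0.le (ENNReal.inv_ne_top.2 (mul_ne_zero ?_ ?_))
      · simpa using pow_pos hr _
      · exact (Metric.measure_ball_pos _ _ one_pos).ne'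
    have h1 := ENNReal.mul_ne_top ENNReal.ofNat_ne_top (ENNReal.mul_ne_top
      (ENNReal.rpow_ne_top_of_nonneg zero_le_two (ENNReal.ofReal_ne_top (r := r))) hmemD) (a := 2)
    have h2 := ENNReal.mul_ne_top ENNReal.ofNat_ne_top (ENNReal.mul_ne_top hball
      (ENNReal.rpow_ne_top_of_nonneg (by positivity : 0 ≤ 2 / p) hmemp)) (a := 2)
    replace h := ENNReal.toReal_mono (ENNReal.add_ne_top.2 ⟨h1, h2⟩) h
    rw [ENNReal.toReal_add h1 h2] at h
    simp only [ENNReal.toReal_mul, ← ENNReal.toReal_rpow, ENNReal.toReal_inv, hA2, hB2, hG2,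
      ENNReal.toReal_ofNat, ENNReal.toReal_ofReal hr.le, Real.rpow_two,
      ENNReal.toReal_ofReal (pow_nonneg hr.le _)] at h
    convert h using 4
    rw [← hV, ← he, mul_inv, Real.mul_rpow (by positivity) (by positivity), mul_comm K,
      Real.inv_rpow (by positivity), Real.rpow_neg hr.le, Real.rpow_mul hr.le]
    simp [E, hKdef]
  have hfin := Real.rpow_le_rpow (by positivity)
    (rpow_le_of_forall_le hA0 hG0 hK.le (by positivity) hmain) hp0.le
  rw [← Real.rpow_mul hA0, Real.mul_rpow (by positivity) (by positivity),
    Real.mul_rpow (sq_nonneg B) (by positivity), ← Real.rpow_mul hG0, ← Real.rpow_two,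
    ← Real.rpow_mul hB0, mul_assoc (d : ℝ), hep, mul_comm (d : ℝ) α] at hfin
  rw [show α * d + 4 - 2 * α = (2 + d * e) * p by rw [add_mul, mul_assoc, hep, hpdef]; ring,
    mul_assoc]
  exact hfin
end

section
/- Let d ≥ 1 and α ∈ (0,1]. There exists a constant C > 0 such that for every Schwartz function g : ℝ^d → ℂ, ‖g‖_{L²(ℝ^d)}^{αd + 8 − 4α} ≤ C · ‖g‖_{L^{2−α}(ℝ^d)}^{4(2−α)} · ‖Δg‖_{L²(ℝ^d)}^{αd}. -/
open MeasureTheory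

open Real FourierTransform SchwartzMap Laplacian

theorem rpow_le_of_forall_sq_le_s7 {n b D C e p : ℝ} (hn : 0 ≤ n) (hb : 0 ≤ b) (hD : 0 ≤ D)
    (hC : 0 < C) (he : 0 < e) (hp : 0 < p)
    (h : ∀ r > 0, n ^ 2 ≤ C * b ^ 2 * r ^ (-(e / p)) + r ^ 4 / 2 * D) :
    n ^ (e + 4 * p) ≤ (2 * C) ^ (2 * p) * b ^ (4 * p) * (D ^ ((1 : ℝ) / 2)) ^ e := by
  rcases hn.eq_or_lt with rfl | hn
  · rw [zero_rpow (by positivity)]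
    positivity
  rcases hb.eq_or_lt with rfl | hb
  · exfalso
    have hw : ((n ^ 2 / (D + 1)) ^ ((1 : ℝ) / 4)) ^ 4 = n ^ 2 / (D + 1) := by
      rw [← rpow_natCast (_ ^ _) 4, ← rpow_mul (by positivity)]
      norm_num
    have hr := h ((n ^ 2 / (D + 1)) ^ ((1 : ℝ) / 4)) (by positivity)
    rw [hw, zero_pow two_ne_zero, mul_zero, zero_mul, zero_add, div_div, div_mul_eq_mul_div,
      le_div_iff₀ (by positivity)] at hr
    nlinarith [mul_nonneg (sq_nonneg n) hD, pow_pos hn 2]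
  · set q := 2 * C * b ^ 2 / n ^ 2 with hq
    have hq0 : 0 < q := by positivity
    have hr := h (q ^ (p / e)) (by positivity)
    rw [← rpow_mul hq0.le, ← rpow_natCast (_ ^ _) 4, ← rpow_mul hq0.le,
      show p / e * -(e / p) = -1 by field_simp, rpow_neg_one] at hr
    have h1 : C * b ^ 2 * q⁻¹ = n ^ 2 / 2 := by rw [hq]; field_simp
    rw [h1] at hr
    have h2 : n ^ 2 ≤ q ^ (p / e * (4 : ℕ)) * D := by linarith
    have h3 := rpow_le_rpow (by positivity) h2 (by positivity : 0 ≤ e / 2)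
    rw [mul_rpow (by positivity) hD, ← rpow_mul hq0.le, ← rpow_natCast n 2, ← rpow_mul hn.le,
      show p / e * (4 : ℕ) * (e / 2) = 2 * p by push_cast; field_simp; norm_num,
      show ((2 : ℕ) : ℝ) * (e / 2) = e by push_cast; ring, hq,
      div_rpow (by positivity) (by positivity), mul_rpow (by positivity) (by positivity),
      ← rpow_natCast b 2, ← rpow_mul hb.le, ← rpow_natCast n 2, ← rpow_mul hn.le,
      show ((2 : ℕ) : ℝ) * (2 * p) = 4 * p by push_cast; ring, div_mul_eq_mul_div,
      le_div_iff₀ (by positivity)] at h3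
    rwa [rpow_add hn, ← rpow_mul hD, one_div_mul_eq_div]

/-- Jensen's inequality for averages against a probability density. -/
theorem norm_integral_smul_rpow_le {X F : Type*} [MeasurableSpace X] {μ : Measure X}
    [NormedAddCommGroup F] [NormedSpace ℝ F] {φ : X → ℝ} {f : X → F} {p : ℝ} (hp : 1 ≤ p)
    (hφ0 : ∀ x, 0 ≤ φ x) (hφ : Integrable φ μ) (hφm : Measurable φ) (hφ1 : ∫ x, φ x ∂μ = 1)
    (hf : Integrable (fun x ↦ φ x * ‖f x‖) μ)
    (hfp : Integrable (fun x ↦ φ x * ‖f x‖ ^ p) μ) :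
    ‖∫ x, φ x • f x ∂μ‖ ^ p ≤ ∫ x, φ x * ‖f x‖ ^ p ∂μ := by
  set ν := μ.withDensity (fun x ↦ ENNReal.ofReal (φ x)) with hν
  have hprob : IsProbabilityMeasure ν := by
    refine ⟨?_⟩
    rw [hν, withDensity_apply _ MeasurableSet.univ, Measure.restrict_univ,
      ← ofReal_integral_eq_lintegral_ofReal hφ (.of_forall hφ0), hφ1, ENNReal.ofReal_one]
  have hint (u : X → ℝ) : ∫ x, u x ∂ν = ∫ x, φ x * u x ∂μ := by
    rw [hν, integral_withDensity_eq_integral_toReal_smul (by fun_prop) (by simp)]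
    simp [ENNReal.toReal_ofReal, hφ0]
  have hintg (u : X → ℝ) : Integrable u ν ↔ Integrable (fun x ↦ φ x * u x) μ := by
    rw [hν, integrable_withDensity_iff (by fun_prop) (by simp)]
    simp [ENNReal.toReal_ofReal, hφ0, mul_comm]
  have hJ := (convexOn_rpow hp).map_integral_le (μ := ν) (f := fun x ↦ ‖f x‖)
    (continuous_rpow_const (by linarith)).continuousOn isClosed_Ici (.of_forall fun x ↦ by simp)
    ((hintg _).2 hf) ((hintg _).2 hfp)
  rw [hint, hint] at hJ
  refine le_trans (rpow_le_rpow (norm_nonneg _) ?_ (by linarith)) hJ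
  refine (norm_integral_le_integral_norm _).trans_eq ?_
  simp [norm_smul, abs_of_nonneg, hφ0]

section

variable {E : Type*} [NormedAddCommGroup E] [InnerProductSpace ℝ E] [FiniteDimensional ℝ E]
  [MeasurableSpace E] [BorelSpace E]

namespace SchwartzMap

theorem integrable_norm_rpow (g : 𝓢(E, ℂ)) {p : ℝ} (hp : 1 ≤ p) :
    Integrable (fun x ↦ ‖g x‖ ^ p) := by
  have := (g.memLp (ENNReal.ofReal p) volume).integrable_norm_rpow
    (by simp; linarith) (by simp)
  rwa [ENNReal.toReal_ofReal (by linarith)] at this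

theorem norm_fourier_laplacian (g : 𝓢(E, ℂ)) (ξ : E) :
    ‖𝓕 (Δ g) ξ‖ = (2 * π) ^ 2 * ‖ξ‖ ^ 2 * ‖𝓕 g ξ‖ := by
  have hg : (fun x : E ↦ ‖x‖ ^ 2).HasTemperateGrowth := by fun_prop
  rw [laplacian_eq_fourierMultiplierCLM, fourierMultiplierCLM_apply, FourierTransform.fourier_smul,
    fourier_fourierInv_eq, smul_apply, smulLeftCLM_apply_apply hg, norm_smul, norm_smul, mul_assoc]
  simp [abs_of_pos pi_pos]

theorem toReal_eLpNorm_eq (g : 𝓢(E, ℂ)) {p : ℝ} (hp : 0 < p) :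
    (eLpNorm g (ENNReal.ofReal p) volume).toReal = (∫ x, ‖g x‖ ^ p) ^ (1 / p) := by
  rw [(g.memLp _ volume).eLpNorm_eq_integral_rpow_norm (by simpa using hp) (by simp),
    ENNReal.toReal_ofReal (by positivity), ENNReal.toReal_ofReal hp.le, one_div]

end SchwartzMap

namespace ContDiffBump

/-- A normalized bump function as a complex-valued Schwartz function. -/
noncomputable def normedSchwartz (φ : ContDiffBump (0 : E)) : 𝓢(E, ℂ) :=
  HasCompactSupport.toSchwartzMap (f := fun x ↦ (φ.normed volume x : ℂ))
    (φ.hasCompactSupport_normed.comp_left Complex.ofReal_zero)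
    (Complex.ofRealCLM.contDiff.comp φ.contDiff_normed)

@[simp]
theorem normedSchwartz_apply (φ : ContDiffBump (0 : E)) (x : E) :
    φ.normedSchwartz x = (φ.normed volume x : ℂ) := rfl

theorem norm_one_sub_fourier_normedSchwartz_le (φ : ContDiffBump (0 : E)) (ξ : E) :
    ‖1 - 𝓕 φ.normedSchwartz ξ‖ ≤ 2 * π ^ 2 * φ.rOut ^ 2 * ‖ξ‖ ^ 2 := by
  set θ : E → ℝ := fun v ↦ 2 * π * inner ℝ v ξ with hθ
  set w : E → ℝ := φ.normed volume with hw
  have hF : Integrable (fun v : E ↦ Complex.exp (↑(-2 * π * inner ℝ v ξ) * Complex.I) •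
      φ.normedSchwartz v) := by
    refine φ.normedSchwartz.integrable.bdd_mul (c := 1) (by fun_prop) (.of_forall fun v ↦ ?_)
    rw [Complex.norm_exp_ofReal_mul_I]
  have hcos : Integrable (fun v ↦ w v * cos (θ v)) := by
    refine φ.integrable_normed.mul_bdd (c := 1) (by fun_prop) (.of_forall fun v ↦ ?_)
    exact abs_cos_le_one _
  have hreal : 𝓕 φ.normedSchwartz ξ = ((∫ v, w v * cos (θ v) : ℝ) : ℂ) := by
    have h2 : 2 * 𝓕 φ.normedSchwartz ξ = 2 * ((∫ v, w v * cos (θ v) : ℝ) : ℂ) := by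
      rw [fourier_coe, fourier_eq', two_mul]
      nth_rw 2 [← integral_neg_eq_self]
      rw [← integral_add hF hF.comp_neg, ← integral_complex_ofReal, ← integral_const_mul]
      congr 1 with v
      have e1 : ((-2 * π * inner ℝ v ξ : ℝ) : ℂ) * Complex.I = -(θ v : ℂ) * Complex.I := by
        simp [hθ]
      have e2 : ((-2 * π * inner ℝ (-v) ξ : ℝ) : ℂ) * Complex.I = (θ v : ℂ) * Complex.I := by
        simp [hθ]
      rw [e1, e2, normedSchwartz_apply, normedSchwartz_apply, φ.normed_neg, smul_eq_mul,
        smul_eq_mul, Complex.ofReal_mul (w v), Complex.ofReal_cos, Complex.cos]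
      ring
    exact mul_left_cancel₀ two_ne_zero h2
  have hone : 1 - 𝓕 φ.normedSchwartz ξ = ((∫ v, w v * (1 - cos (θ v)) : ℝ) : ℂ) := by
    simp_rw [mul_sub, mul_one]
    rw [integral_sub φ.integrable_normed hcos, φ.integral_normed, hreal]
    push_cast
    rfl
  have hbound (v : E) : w v * (1 - cos (θ v)) ≤
      w v * (2 * π ^ 2 * φ.rOut ^ 2 * ‖ξ‖ ^ 2) := by
    by_cases hv : v ∈ Function.support w
    · refine mul_le_mul_of_nonneg_left ?_ (φ.nonneg_normed v)
      rw [hw, φ.support_normed_eq, mem_ball_zero_iff] at hv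
      have h1 : (inner ℝ v ξ : ℝ) ^ 2 ≤ φ.rOut ^ 2 * ‖ξ‖ ^ 2 := by
        rw [← mul_pow, sq_le_sq, abs_of_nonneg (mul_nonneg φ.rOut_pos.le (norm_nonneg ξ))]
        exact (abs_real_inner_le_norm v ξ).trans (by gcongr)
      calc 1 - cos (θ v) ≤ θ v ^ 2 / 2 := by linarith [one_sub_sq_div_two_le_cos (x := θ v)]
        _ = 2 * π ^ 2 * (inner ℝ v ξ : ℝ) ^ 2 := by rw [hθ]; ring
        _ ≤ 2 * π ^ 2 * (φ.rOut ^ 2 * ‖ξ‖ ^ 2) := by gcongr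
        _ = _ := by ring
    · simp [Function.notMem_support.1 hv]
  have hnonneg (v : E) : 0 ≤ w v * (1 - cos (θ v)) :=
    mul_nonneg (φ.nonneg_normed v) (by linarith [cos_le_one (θ v)])
  rw [hone, Complex.norm_real, norm_of_nonneg (integral_nonneg hnonneg)]
  refine (integral_mono_of_nonneg (.of_forall hnonneg) (φ.integrable_normed.mul_const _)
    (.of_forall hbound)).trans_eq ?_
  rw [integral_mul_const, φ.integral_normed, one_mul]

theorem norm_convolution_rpow_le (φ : ContDiffBump (0 : E)) (g : 𝓢(E, ℂ)) {p : ℝ} (hp : 1 ≤ p)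
    (x : E) :
    ‖convolution (.mul ℂ ℂ) φ.normedSchwartz g x‖ ^ p ≤
      ∫ t, φ.normed volume t * ‖g (x - t)‖ ^ p := by
  obtain ⟨K, -, hK⟩ := g.decay 0 0
  replace hK (y : E) : ‖g y‖ ≤ K := by simpa using hK y
  rw [convolution_apply, MeasureTheory.convolution_def]
  have hmul (q : ℝ) (hq : 0 ≤ q) :
      Integrable (fun t ↦ φ.normed volume t * ‖g (x - t)‖ ^ q) := by
    refine φ.integrable_normed.mul_bdd (c := K ^ q) ?_ (.of_forall fun t ↦ ?_)
    · exact Continuous.aestronglyMeasurable (Continuous.rpow_const (by fun_prop) (by simp [hq]))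
    · rw [norm_of_nonneg (by positivity)]
      exact rpow_le_rpow (norm_nonneg _) (hK _) hq
  simpa using norm_integral_smul_rpow_le (f := fun t ↦ g (x - t)) hp φ.nonneg_normed
    φ.integrable_normed φ.continuous_normed.measurable φ.integral_normed
    (by simpa using hmul 1 zero_le_one) (hmul p (by linarith))

theorem integral_norm_convolution_rpow_le (φ : ContDiffBump (0 : E)) (g : 𝓢(E, ℂ)) {p : ℝ}
    (hp : 1 ≤ p) :
    ∫ x, ‖convolution (.mul ℂ ℂ) φ.normedSchwartz g x‖ ^ p ≤ ∫ x, ‖g x‖ ^ p := by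
  have hg := integrable_norm_rpow g hp
  refine (integral_mono (integrable_norm_rpow _ hp)
    (φ.integrable_normed.integrable_convolution (.mul ℝ ℝ) hg)
    (φ.norm_convolution_rpow_le g hp)).trans_eq ?_
  rw [integral_convolution (.mul ℝ ℝ) φ.integrable_normed hg]
  simp [φ.integral_normed]

theorem norm_convolution_rpow_le_mul_integral (φ : ContDiffBump (0 : E)) (g : 𝓢(E, ℂ)) {p M : ℝ}
    (hp : 1 ≤ p) (hM : ∀ x, φ.normed volume x ≤ M) (x : E) :
    ‖convolution (.mul ℂ ℂ) φ.normedSchwartz g x‖ ^ p ≤ M * ∫ y, ‖g y‖ ^ p := by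
  have hg := integrable_norm_rpow g hp
  refine (φ.norm_convolution_rpow_le g hp x).trans ?_
  rw [← integral_sub_left_eq_self (fun y ↦ ‖g y‖ ^ p) volume x, ← integral_const_mul]
  refine integral_mono_of_nonneg (.of_forall fun t ↦ ?_) ((hg.comp_sub_left x).const_mul M)
    (.of_forall fun t ↦ ?_)
  · exact mul_nonneg (φ.nonneg_normed t) (by positivity)
  · exact mul_le_mul_of_nonneg_right (hM t) (by positivity)

theorem integral_norm_convolution_sq_le (φ : ContDiffBump (0 : E)) (g : 𝓢(E, ℂ)) {p M : ℝ}
    (hp : 1 ≤ p) (hp2 : p ≤ 2) (hM : ∀ x, φ.normed volume x ≤ M) :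
    ∫ x, ‖convolution (.mul ℂ ℂ) φ.normedSchwartz g x‖ ^ 2 ≤
      M ^ ((2 - p) / p) * ((∫ x, ‖g x‖ ^ p) ^ (1 / p)) ^ 2 := by
  set h := convolution (.mul ℂ ℂ) φ.normedSchwartz g
  set A := ∫ x, ‖g x‖ ^ p
  have hA : 0 ≤ A := integral_nonneg fun x ↦ by positivity
  have hM0 : 0 ≤ M := (φ.nonneg_normed 0).trans (hM 0)
  have hp0 : 0 < p := by linarith
  have hpt (x : E) : ‖h x‖ ^ 2 ≤ (M * A) ^ ((2 - p) / p) * ‖h x‖ ^ p := by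
    have h1 := rpow_le_rpow (by positivity) (φ.norm_convolution_rpow_le_mul_integral g hp hM x)
      (by have : 0 ≤ 2 - p := by linarith
          positivity : 0 ≤ (2 - p) / p)
    rw [← rpow_mul (norm_nonneg _), mul_div_cancel₀ _ hp0.ne'] at h1
    calc ‖h x‖ ^ 2 = ‖h x‖ ^ (2 - p) * ‖h x‖ ^ p := by
          rw [← rpow_add_of_nonneg (norm_nonneg _) (by linarith) hp0.le, sub_add_cancel, rpow_two]
      _ ≤ _ := by gcongr
  calc ∫ x, ‖h x‖ ^ 2 ≤ ∫ x, (M * A) ^ ((2 - p) / p) * ‖h x‖ ^ p :=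
        integral_mono_of_nonneg (.of_forall fun x ↦ by positivity)
          ((integrable_norm_rpow h hp).const_mul _) (.of_forall hpt)
    _ = (M * A) ^ ((2 - p) / p) * ∫ x, ‖h x‖ ^ p := integral_const_mul _ _
    _ ≤ (M * A) ^ ((2 - p) / p) * A := by
        gcongr
        exact φ.integral_norm_convolution_rpow_le g hp
    _ = M ^ ((2 - p) / p) * (A ^ (1 / p)) ^ 2 := by
        rw [mul_rpow hM0 hA, mul_assoc, ← rpow_natCast (A ^ _) 2, ← rpow_mul hA]
        congr 1
        rcases hA.eq_or_lt with h0 | h0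
        · rw [← h0, mul_zero, zero_rpow (by positivity)]
        · rw [← rpow_add_one h0.ne']
          congr 1
          field_simp
          push_cast
          ring

theorem integral_norm_sq_le (φ : ContDiffBump (0 : E)) (g : 𝓢(E, ℂ)) :
    ∫ x, ‖g x‖ ^ 2 ≤ 2 * (∫ x, ‖convolution (.mul ℂ ℂ) φ.normedSchwartz g x‖ ^ 2) +
      φ.rOut ^ 4 / 2 * ∫ x, ‖Δ g x‖ ^ 2 := by
  set h := convolution (.mul ℂ ℂ) φ.normedSchwartz g with hh
  have hint (f : 𝓢(E, ℂ)) : Integrable (fun x ↦ ‖f x‖ ^ 2) := by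
    simpa using integrable_norm_rpow f one_le_two
  have hpt (ξ : E) : ‖𝓕 g ξ‖ ^ 2 ≤ 2 * ‖𝓕 h ξ‖ ^ 2 + φ.rOut ^ 4 / 2 * ‖𝓕 (Δ g) ξ‖ ^ 2 := by
    have h1 : 𝓕 g ξ = 𝓕 h ξ + (1 - 𝓕 φ.normedSchwartz ξ) * 𝓕 g ξ := by
      rw [hh, fourier_convolution, pairing_apply_apply]
      simp
      ring
    have h2 : ‖(1 - 𝓕 φ.normedSchwartz ξ) * 𝓕 g ξ‖ ≤ φ.rOut ^ 2 / 2 * ‖𝓕 (Δ g) ξ‖ := by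
      rw [norm_mul, norm_fourier_laplacian]
      calc _ ≤ 2 * π ^ 2 * φ.rOut ^ 2 * ‖ξ‖ ^ 2 * ‖𝓕 g ξ‖ := by
            gcongr
            exact φ.norm_one_sub_fourier_normedSchwartz_le ξ
        _ = _ := by ring
    have h3 : ‖𝓕 g ξ‖ ≤ ‖𝓕 h ξ‖ + φ.rOut ^ 2 / 2 * ‖𝓕 (Δ g) ξ‖ := by
      conv_lhs => rw [h1]
      exact (norm_add_le _ _).trans (by gcongr)
    calc ‖𝓕 g ξ‖ ^ 2 ≤ (‖𝓕 h ξ‖ + φ.rOut ^ 2 / 2 * ‖𝓕 (Δ g) ξ‖) ^ 2 := by gcongr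
      _ ≤ 2 * (‖𝓕 h ξ‖ ^ 2 + (φ.rOut ^ 2 / 2 * ‖𝓕 (Δ g) ξ‖) ^ 2) := add_sq_le
      _ = _ := by ring
  have := integral_mono (hint (𝓕 g)) (((hint (𝓕 h)).const_mul 2).add
    ((hint (𝓕 (Δ g))).const_mul (φ.rOut ^ 4 / 2))) hpt
  simp only [Pi.add_apply] at this
  rwa [integral_add ((hint (𝓕 h)).const_mul 2) ((hint (𝓕 (Δ g))).const_mul _),
    integral_const_mul, integral_const_mul, integral_norm_sq_fourier, integral_norm_sq_fourier,
    integral_norm_sq_fourier] at this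

end ContDiffBump

open Module in
theorem exists_integral_norm_sq_le {p : ℝ} (hp : 1 ≤ p) (hp2 : p ≤ 2) :
    ∃ C > 0, ∀ (g : 𝓢(E, ℂ)) (r : ℝ), 0 < r → ∫ x, ‖g x‖ ^ 2 ≤
      C * ((∫ x, ‖g x‖ ^ p) ^ (1 / p)) ^ 2 * r ^ (-((2 - p) * finrank ℝ E / p)) +
        r ^ 4 / 2 * ∫ x, ‖Δ g x‖ ^ 2 := by
  set c := (2 : ℝ) ^ finrank ℝ E / volume.real (Metric.ball (0 : E) 1)
  have hc : 0 < c := div_pos (by positivity)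
    (ENNReal.toReal_pos (Metric.measure_ball_pos _ _ one_pos).ne' measure_ball_lt_top.ne)
  refine ⟨2 * c ^ ((2 - p) / p), by positivity, fun g r hr ↦ ?_⟩
  let φ : ContDiffBump (0 : E) := ⟨r / 2, r, by positivity, by linarith⟩
  have hM (x : E) : φ.normed volume x ≤ c * r ^ (-(finrank ℝ E : ℝ)) := by
    refine (φ.normed_le_div_measure_closedBall_rOut volume 2 ?_ x).trans_eq ?_
    · change r ≤ 2 * (r / 2)
      linarith
    · change _ / volume.real (Metric.closedBall (0 : E) r) = _
      rw [Measure.addHaar_real_closedBall _ _ hr.le, rpow_neg hr.le, rpow_natCast]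
      simp only [c]
      field_simp
  refine (φ.integral_norm_sq_le g).trans (add_le_add ?_ le_rfl)
  refine (mul_le_mul_of_nonneg_left (φ.integral_norm_convolution_sq_le g hp hp2 hM)
    two_pos.le).trans_eq ?_
  rw [mul_rpow hc.le (by positivity), ← rpow_mul hr.le,
    show -(finrank ℝ E : ℝ) * ((2 - p) / p) = -((2 - p) * finrank ℝ E / p) by ring]
  ring

end

/-- Nash-type inequality with two derivatives. For d ≥ 1 and α ∈ (0,1], there is
C > 0 such that for every Schwartz function g : ℝ^d → ℂ,
‖g‖₂^{αd+8−4α} ≤ C ‖g‖_{2−α}^{4(2−α)} ‖Δg‖₂^{αd}, where Δg is the sum of second partial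
derivatives of g. -/
theorem stmt_7 (d : ℕ) (hd : 1 ≤ d) (α : ℝ) (hα : 0 < α) (hα1 : α ≤ 1) :
    ∃ C > 0, ∀ g : SchwartzMap (EuclideanSpace ℝ (Fin d)) ℂ,
      (eLpNorm (⇑g) 2 volume).toReal ^ (α * d + 8 - 4 * α) ≤
        C * (eLpNorm (⇑g) (ENNReal.ofReal (2 - α)) volume).toReal ^ (4 * (2 - α)) *
          ((∫ x : EuclideanSpace ℝ (Fin d),
              ‖∑ i : Fin d, iteratedFDeriv ℝ 2 (⇑g) x
                  ![EuclideanSpace.single i 1, EuclideanSpace.single i 1]‖ ^ 2) ^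
            ((1 : ℝ) / 2)) ^ (α * d) := by
  have hp : 1 ≤ 2 - α := by linarith
  have hd0 : (0 : ℝ) < d := by exact_mod_cast hd
  obtain ⟨C, hC, h⟩ := exists_integral_norm_sq_le (E := EuclideanSpace ℝ (Fin d)) hp (by linarith)
  refine ⟨(2 * C) ^ (2 * (2 - α)), by positivity, fun g ↦ ?_⟩
  have hΔ : ∫ x, ‖∑ i : Fin d, iteratedFDeriv ℝ 2 g x
      ![EuclideanSpace.single i 1, EuclideanSpace.single i 1]‖ ^ 2 = ∫ x, ‖Δ g x‖ ^ 2 := by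
    congr 1 with x
    rw [laplacian_apply, InnerProductSpace.laplacian_eq_iteratedFDeriv_orthonormalBasis g
      (EuclideanSpace.basisFun (Fin d) ℝ)]
    simp
  rw [hΔ, show α * d + 8 - 4 * α = α * d + 4 * (2 - α) by ring]
  refine rpow_le_of_forall_sq_le_s7 ENNReal.toReal_nonneg ENNReal.toReal_nonneg
    (integral_nonneg fun x ↦ by positivity) hC (by positivity) (by linarith) fun r hr ↦ ?_
  have h2 : (eLpNorm g 2 volume).toReal ^ 2 = ∫ x, ‖g x‖ ^ 2 := by
    have := toReal_eLpNorm_eq g two_pos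
    rw [ENNReal.ofReal_ofNat] at this
    rw [this, ← sqrt_eq_rpow, sq_sqrt (integral_nonneg fun x ↦ by positivity)]
    simp
  rw [h2, toReal_eLpNorm_eq g (by linarith)]
  simpa using h g r hr
end
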